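/- arXiv:1206.6883 — 2 statements merged into one kernel-verified Lean document; each statement's English description precedes it below -/
import Mathlib

section
/- Let J be a finite index set, let n be a positive natural number, let r : J → Fin n be a map assigning each index to one of n instances, and let K_min, K_max, K_av be integers with K_min ≤ K_av ≤ K_max. Consider the polytope S = { p : J → ℝ | (∀ j ∈ J, 0 ≤ p j ≤ 1) ∧ (∀ i : Fin n, K_min ≤ ∑_{j : r j = i} p j ≤ K_max) ∧ (∑_{j ∈ J} p j = K_av · n) }. Then every extreme point of S has all coordinates in {0, 1}. -/
open Finset

/-- The polytope of vectors in the unit cube whose `r`-block sums lie in `[a, b]` and whose total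
sum is `c`. -/
def blockSumPolytope {J ι : Type*} [Fintype J] [DecidableEq ι] (r : J → ι) (a b c : ℝ) :
    Set (J → ℝ) :=
  {p | (∀ j, 0 ≤ p j ∧ p j ≤ 1) ∧
    (∀ i, a ≤ ∑ j ∈ univ.filter (fun j => r j = i), p j ∧
      ∑ j ∈ univ.filter (fun j => r j = i), p j ≤ b) ∧
    ∑ j, p j = c}

/-- A vector `v` such that `p + v` and `p - v` both lie in `S` vanishes if `p` is extreme. -/
theorem eq_zero_of_add_mem_of_sub_mem_of_mem_extremePoints {E : Type*} [AddCommGroup E]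
    [Module ℝ E] {S : Set E} {p v : E} (hp : p ∈ S.extremePoints ℝ) (hadd : p + v ∈ S)
    (hsub : p - v ∈ S) : v = 0 := by
  have hseg : p ∈ openSegment ℝ (p + v) (p - v) :=
    ⟨1 / 2, 1 / 2, by norm_num, by norm_num, by norm_num, by module⟩
  simpa using hp.2 hadd hsub hseg

/-- If a sum of numbers in `[0, 1]` is an integer and one term is fractional, then so is another
one. -/
theorem exists_ne_fractional_of_sum_eq_intCast {J : Type*} {s : Finset J} {p : J → ℝ} {z : ℤ}
    (hp : ∀ j ∈ s, 0 ≤ p j ∧ p j ≤ 1) (hs : ∑ j ∈ s, p j = z) {j : J} (hj : j ∈ s)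
    (hpj : 0 < p j ∧ p j < 1) : ∃ k ∈ s, k ≠ j ∧ 0 < p k ∧ p k < 1 := by
  classical
  by_contra! h
  have hint : ∀ k ∈ s.erase j, p k = ((⌊p k⌋ : ℤ) : ℝ) := by
    intro k hk
    obtain ⟨hkj, hks⟩ := Finset.mem_erase.mp hk
    rcases (hp k hks).1.eq_or_lt with h0 | h0
    · simp [← h0]
    · simp [le_antisymm (hp k hks).2 (h k hks hkj h0)]
  rw [← Finset.add_sum_erase s p hj, Finset.sum_congr rfl hint, ← Int.cast_sum] at hs
  have hz : p j = ((z - ∑ k ∈ s.erase j, ⌊p k⌋ : ℤ) : ℝ) := by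
    rw [Int.cast_sub]; linarith
  rw [hz] at hpj
  have h0 := Int.cast_pos.mp hpj.1
  have h1 : z - ∑ k ∈ s.erase j, ⌊p k⌋ < 1 := by exact_mod_cast hpj.2
  omega

section blockSumPolytope

variable {J ι : Type*} [Fintype J] [DecidableEq ι] {r : J → ι} {a b c : ℝ} {p : J → ℝ}

/-- Moving a small mass `t` from coordinate `k` to coordinate `j` preserves the polytope, provided
the two coordinates share a block or the sums of both blocks have enough slack. -/
theorem add_smul_single_sub_single_mem_blockSumPolytope [DecidableEq J]
    (hp : p ∈ blockSumPolytope r a b c) {j k : J} (hjk : j ≠ k) {t : ℝ}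
    (hj : |t| ≤ p j ∧ |t| ≤ 1 - p j) (hk : |t| ≤ p k ∧ |t| ≤ 1 - p k)
    (hr : r j = r k ∨ ∀ i, i = r j ∨ i = r k →
      |t| ≤ ∑ l ∈ univ.filter (fun l => r l = i), p l - a ∧
        |t| ≤ b - ∑ l ∈ univ.filter (fun l => r l = i), p l) :
    p + t • (Pi.single j (1 : ℝ) - Pi.single k 1) ∈ blockSumPolytope r a b c := by
  obtain ⟨hbox, hblock, hsum⟩ := hp
  have hle := le_abs_self t
  have hge := neg_abs_le t
  refine ⟨fun l => ?_, fun i => ?_, ?_⟩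
  · have hl := hbox l
    by_cases hlj : l = j
    · subst hlj
      simp only [Pi.add_apply, Pi.smul_apply, Pi.sub_apply, Pi.single_eq_same,
        Pi.single_eq_of_ne hjk, smul_eq_mul]
      constructor <;> linarith
    · by_cases hlk : l = k
      · subst hlk
        simp only [Pi.add_apply, Pi.smul_apply, Pi.sub_apply, Pi.single_eq_same,
          Pi.single_eq_of_ne hlj, smul_eq_mul]
        constructor <;> linarith
      · simpa [Pi.single_eq_of_ne hlj, Pi.single_eq_of_ne hlk] using hl
  · have hi := hblock i
    simp only [Pi.add_apply, Pi.smul_apply, Pi.sub_apply, smul_eq_mul, Finset.sum_add_distrib,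
      ← Finset.mul_sum, Finset.sum_sub_distrib,
      Pi.single_apply, Finset.sum_ite_eq', Finset.mem_filter, Finset.mem_univ, true_and]
    rcases hr with hr | hr
    · simpa [hr] using hi
    · have hi' := hr i
      split_ifs with h1 h2 h2
      · simpa using hi
      · have := hi' (Or.inl h1.symm)
        constructor <;> linarith
      · have := hi' (Or.inr h2.symm)
        constructor <;> linarith
      · simpa using hi
  · simp [Finset.sum_add_distrib, ← Finset.mul_sum, hsum]

/-- An extreme point of the polytope has no two fractional coordinates that share a block or lie in
blocks with slack sums. -/
theorem not_mem_extremePoints_blockSumPolytope {j k : J} (hjk : j ≠ k)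
    (hj : 0 < p j ∧ p j < 1) (hk : 0 < p k ∧ p k < 1)
    (hr : r j = r k ∨ ∀ i, i = r j ∨ i = r k →
      a < ∑ l ∈ univ.filter (fun l => r l = i), p l ∧
        ∑ l ∈ univ.filter (fun l => r l = i), p l < b) :
    p ∉ (blockSumPolytope r a b c).extremePoints ℝ := by
  classical
  intro hp
  obtain ⟨ε, hε, hεj, hεk, hεr⟩ : ∃ ε : ℝ, 0 < ε ∧ (ε ≤ p j ∧ ε ≤ 1 - p j) ∧
      (ε ≤ p k ∧ ε ≤ 1 - p k) ∧ (r j = r k ∨ ∀ i, i = r j ∨ i = r k →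
        ε ≤ ∑ l ∈ univ.filter (fun l => r l = i), p l - a ∧
          ε ≤ b - ∑ l ∈ univ.filter (fun l => r l = i), p l) := by
    have hsmall : ∀ {x : ℝ}, 0 < x → ∀ᶠ ε in nhdsWithin (0 : ℝ) (Set.Ioi 0), ε ≤ x :=
      fun hx => (eventually_le_nhds hx).filter_mono nhdsWithin_le_nhds
    have hslack : ∀ᶠ ε in nhdsWithin (0 : ℝ) (Set.Ioi 0),
        r j = r k ∨ ∀ i, i = r j ∨ i = r k →
          ε ≤ ∑ l ∈ univ.filter (fun l => r l = i), p l - a ∧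
            ε ≤ b - ∑ l ∈ univ.filter (fun l => r l = i), p l := by
      rcases hr with hr | hr
      · exact Filter.Eventually.of_forall fun _ => Or.inl hr
      · have hrj := hr _ (Or.inl rfl)
        have hrk := hr _ (Or.inr rfl)
        filter_upwards [hsmall (sub_pos.mpr hrj.1), hsmall (sub_pos.mpr hrj.2),
          hsmall (sub_pos.mpr hrk.1), hsmall (sub_pos.mpr hrk.2)] with ε h1 h2 h3 h4
        right
        rintro i (rfl | rfl)
        exacts [⟨h1, h2⟩, ⟨h3, h4⟩]
    have hpos : ∀ᶠ ε in nhdsWithin (0 : ℝ) (Set.Ioi 0), 0 < ε := self_mem_nhdsWithin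
    exact (hpos.and (((hsmall hj.1).and (hsmall (sub_pos.mpr hj.2))).and
      (((hsmall hk.1).and (hsmall (sub_pos.mpr hk.2))).and hslack))).exists
  have hmem : ∀ t : ℝ, |t| = ε →
      p + t • (Pi.single j (1 : ℝ) - Pi.single k 1) ∈ blockSumPolytope r a b c := by
    rintro t rfl
    exact add_smul_single_sub_single_mem_blockSumPolytope hp.1 hjk hεj hεk hεr
  have hzero := eq_zero_of_add_mem_of_sub_mem_of_mem_extremePoints hp
    (hmem ε (abs_of_pos hε))
    (by simpa only [neg_smul, ← sub_eq_add_neg] using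
      hmem (-ε) (by rw [abs_neg, abs_of_pos hε]))
  have hj0 := congrFun hzero j
  simp [Pi.single_eq_of_ne hjk, hε.ne'] at hj0

/-- If the block bounds and the total sum are integers, every extreme point of the polytope is a
`0`-`1` vector. -/
theorem eq_zero_or_one_of_mem_extremePoints_blockSumPolytope {A B C : ℤ}
    (hp : p ∈ (blockSumPolytope r (A : ℝ) B C).extremePoints ℝ) (j : J) :
    p j = 0 ∨ p j = 1 := by
  obtain ⟨hbox, hblock, hsum⟩ := hp.1
  by_contra! hj
  have hfrac : 0 < p j ∧ p j < 1 :=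
    ⟨(hbox j).1.lt_of_ne hj.1.symm, (hbox j).2.lt_of_ne hj.2⟩
  have hne : ∀ l, 0 < p l ∧ p l < 1 → ∀ z : ℤ,
      ∑ m ∈ univ.filter (fun m => r m = r l), p m ≠ z := by
    intro l hl z hz
    obtain ⟨m, hm, hml, hpm⟩ :=
      exists_ne_fractional_of_sum_eq_intCast (fun m _ => hbox m) hz (by simp) hl
    exact not_mem_extremePoints_blockSumPolytope hml hpm hl
      (Or.inl (Finset.mem_filter.mp hm).2) hp
  obtain ⟨k, -, hkj, hk⟩ :=
    exists_ne_fractional_of_sum_eq_intCast (fun m _ => hbox m) hsum (Finset.mem_univ j) hfrac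
  refine not_mem_extremePoints_blockSumPolytope hkj hk hfrac (Or.inr ?_) hp
  rintro i (rfl | rfl)
  · exact ⟨(hblock _).1.lt_of_ne (hne k hk A).symm, (hblock _).2.lt_of_ne (hne k hk B)⟩
  · exact ⟨(hblock _).1.lt_of_ne (hne j hfrac A).symm, (hblock _).2.lt_of_ne (hne j hfrac B)⟩

end blockSumPolytope

/-- Every extreme point of the LNML target-neighborhood polytope
`S = { p | 0 ≤ p ≤ 1, K_min ≤ (block sums) ≤ K_max, total sum = K_av · n }`
has all coordinates in `{0, 1}`. -/
theorem extremePoints_of_LNML_polytope_are_zero_one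
    {J : Type*} [Fintype J] (n : ℕ) (hn : 0 < n) (r : J → Fin n)
    (Kmin Kmax Kav : ℤ) (h₁ : Kmin ≤ Kav) (h₂ : Kav ≤ Kmax)
    (S : Set (J → ℝ))
    (hS : S = {p : J → ℝ |
      (∀ j, 0 ≤ p j ∧ p j ≤ 1) ∧
      (∀ i : Fin n,
        (Kmin : ℝ) ≤ ∑ j ∈ univ.filter (fun j => r j = i), p j ∧
        ∑ j ∈ univ.filter (fun j => r j = i), p j ≤ (Kmax : ℝ)) ∧
      (∑ j, p j = (Kav : ℝ) * n)}) :
    ∀ p ∈ S.extremePoints ℝ, ∀ j, p j = 0 ∨ p j = 1 := by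
  intro p hp
  have hS' : S = blockSumPolytope r (Kmin : ℝ) Kmax ((Kav * n : ℤ) : ℝ) := by
    rw [hS, blockSumPolytope]
    push_cast
    rfl
  rw [hS'] at hp
  exact eq_zero_or_one_of_mem_extremePoints_blockSumPolytope hp
end

section
/- Let J be a finite index set, let n be a positive natural number, let r : J → Fin n, and let K_min, K_max, K_av be integers with K_min ≤ K_av ≤ K_max. Let S = { p : J → ℝ | (∀ j ∈ J, 0 ≤ p j ≤ 1) ∧ (∀ i : Fin n, K_min ≤ ∑_{j : r j = i} p j ≤ K_max) ∧ (∑_{j ∈ J} p j = K_av · n) }. If S is nonempty, then for every cost vector f : J → ℝ there exists p* ∈ S with all coordinates in {0, 1} such that ∑_{j ∈ J} f j · p* j ≤ ∑_{j ∈ J} f j · p j for every p ∈ S. -/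
open Finset

/-- The polytope of target-neighborhood vectors: box constraints, bounds on each group sum, and a
prescribed total. -/
def neighborhoodPolytope {J : Type*} [Fintype J] {n : ℕ} (r : J → Fin n) (Kmin Kmax Kav : ℤ) :
    Set (J → ℝ) :=
  {p : J → ℝ |
    (∀ j, 0 ≤ p j ∧ p j ≤ 1) ∧
    (∀ i : Fin n,
      (Kmin : ℝ) ≤ ∑ j ∈ univ.filter (fun j => r j = i), p j ∧
      ∑ j ∈ univ.filter (fun j => r j = i), p j ≤ (Kmax : ℝ)) ∧
    (∑ j, p j = (Kav : ℝ) * n)}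

/-- If all terms but the one at `j` are `0` or `1`, the sum is an integer plus that term. -/
theorem exists_sum_eq_int_add {J : Type*} [DecidableEq J] {s : Finset J} {p : J → ℝ} {j : J}
    (hj : j ∈ s) (h : ∀ k ∈ s, k ≠ j → p k = 0 ∨ p k = 1) :
    ∃ m : ℤ, ∑ k ∈ s, p k = m + p j := by
  refine ⟨∑ k ∈ s.erase j, if p k = 0 then 0 else 1, ?_⟩
  rw [← Finset.sum_erase_add _ _ hj]
  push_cast
  congr 1
  refine Finset.sum_congr rfl fun k hk => ?_
  rcases h k (Finset.mem_of_mem_erase hk) (Finset.ne_of_mem_erase hk) with h0 | h1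
  · simp [h0]
  · simp [h1]

/-- Two fractional coordinates between which mass can be exchanged: they lie in the same group, or
each is the only fractional part of its group sum. -/
def Exchangeable {J : Type*} [Fintype J] {n : ℕ} (r : J → Fin n) (p : J → ℝ) (j k : J) : Prop :=
  r j = r k ∨ (r j ≠ r k ∧
    (∃ m : ℤ, ∑ l ∈ univ.filter (fun l => r l = r j), p l = m + p j) ∧
    (∃ m : ℤ, ∑ l ∈ univ.filter (fun l => r l = r k), p l = m + p k))

theorem Exchangeable.symm {J : Type*} [Fintype J] {n : ℕ} {r : J → Fin n} {p : J → ℝ} {j k : J}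
    (h : Exchangeable r p j k) : Exchangeable r p k j := by
  rcases h with h | ⟨h, hj, hk⟩
  · exact Or.inl h.symm
  · exact Or.inr ⟨h.symm, hk, hj⟩

theorem exists_exchangeable {J : Type*} [Fintype J] {n : ℕ} {r : J → Fin n} {Kmin Kmax Kav : ℤ}
    {p : J → ℝ} (hp : p ∈ neighborhoodPolytope r Kmin Kmax Kav) {j : J}
    (hj : p j ≠ 0 ∧ p j ≠ 1) :
    ∃ j k, j ≠ k ∧ (p j ≠ 0 ∧ p j ≠ 1) ∧ (p k ≠ 0 ∧ p k ≠ 1) ∧ Exchangeable r p j k := by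
  classical
  obtain ⟨hbox, -, htot⟩ := hp
  by_contra! hcon
  have hgroup : ∀ l, (p l ≠ 0 ∧ p l ≠ 1) →
      ∃ m : ℤ, ∑ k ∈ univ.filter (fun k => r k = r l), p k = m + p l := by
    intro l hl
    refine exists_sum_eq_int_add (by simp) fun k hk hkl => ?_
    by_contra! hk'
    exact hcon k l hkl hk' hl (Or.inl (by simpa using hk))
  have hother : ∀ k ∈ (univ : Finset J), k ≠ j → p k = 0 ∨ p k = 1 := by
    intro k _ hkj
    by_contra! hk
    refine hcon k j hkj hk hj ?_
    by_cases hr : r k = r j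
    · exact Or.inl hr
    · exact Or.inr ⟨hr, hgroup k hk, hgroup j hj⟩
  obtain ⟨m, hm⟩ := exists_sum_eq_int_add (mem_univ j) hother
  have hint : p j = ((Kav * n - m : ℤ) : ℝ) := by push_cast; linarith
  have h0 : 0 < p j := lt_of_le_of_ne (hbox j).1 hj.1.symm
  have h1 : p j < 1 := lt_of_le_of_ne (hbox j).2 hj.2
  rw [hint] at h0 h1
  have h0' : 0 < Kav * n - m := by exact_mod_cast h0
  have h1' : Kav * n - m < 1 := by exact_mod_cast h1
  omega

/-- Shifting mass from `k` to `j`, where `j` is no more expensive than `k`, until one of the two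
becomes integral. -/
theorem exists_exchange_step {J : Type*} [Fintype J] {n : ℕ} {r : J → Fin n}
    {Kmin Kmax Kav : ℤ} {p : J → ℝ} (hp : p ∈ neighborhoodPolytope r Kmin Kmax Kav) {j k : J}
    (hjk : j ≠ k) (hj : p j ≠ 0 ∧ p j ≠ 1) (hk : p k ≠ 0 ∧ p k ≠ 1)
    (hex : Exchangeable r p j k) {f : J → ℝ} (hf : f j ≤ f k) :
    ∃ q ∈ neighborhoodPolytope r Kmin Kmax Kav, ∑ l, f l * q l ≤ ∑ l, f l * p l ∧
      (univ.filter fun l => q l ≠ 0 ∧ q l ≠ 1) ⊂ univ.filter fun l => p l ≠ 0 ∧ p l ≠ 1 := by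
  classical
  obtain ⟨hbox, hgrp, htot⟩ := hp
  have hj0 : 0 < p j := lt_of_le_of_ne (hbox j).1 hj.1.symm
  have hj1 : p j < 1 := lt_of_le_of_ne (hbox j).2 hj.2
  have hk0 : 0 < p k := lt_of_le_of_ne (hbox k).1 hk.1.symm
  have hk1 : p k < 1 := lt_of_le_of_ne (hbox k).2 hk.2
  obtain ⟨t, ht0, htj, htk, ht⟩ :
      ∃ t : ℝ, 0 ≤ t ∧ p j + t ≤ 1 ∧ 0 ≤ p k - t ∧ (p j + t = 1 ∨ p k - t = 0) := by
    rcases le_total (1 - p j) (p k) with h | h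
    · exact ⟨1 - p j, by linarith, by linarith, by linarith, Or.inl (by ring)⟩
    · exact ⟨p k, by linarith, by linarith, by linarith, Or.inr (by ring)⟩
  set q : J → ℝ := fun l => p l + (if l = j then t else 0) - (if l = k then t else 0) with hq
  have hqj : q j = p j + t := by simp [hq, hjk]
  have hqk : q k = p k - t := by simp [hq, hjk.symm]
  have hql : ∀ l, l ≠ j → l ≠ k → q l = p l := fun l h h' => by simp [hq, h, h']
  have hsum : ∀ s : Finset J, ∑ l ∈ s, q l =
      ∑ l ∈ s, p l + (if j ∈ s then t else 0) - (if k ∈ s then t else 0) := by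
    intro s
    simp [hq, Finset.sum_add_distrib, Finset.sum_sub_distrib]
  refine ⟨q, ⟨fun l => ?_, fun i => ?_, ?_⟩, ?_, ?_⟩
  · by_cases h : l = j
    · subst h; rw [hqj]; constructor <;> linarith
    by_cases h' : l = k
    · subst h'; rw [hqk]; constructor <;> linarith
    rw [hql l h h']; exact hbox l
  · rw [hsum]
    simp only [mem_filter, mem_univ, true_and]
    rcases hex with h | ⟨hne, ⟨m, hm⟩, ⟨m', hm'⟩⟩
    · rw [h]; simpa using hgrp i
    have key : ∀ (m : ℤ) (a b : ℝ), 0 < a → a < 1 → 0 ≤ b → b ≤ 1 →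
        (Kmin : ℝ) ≤ m + a → m + a ≤ (Kmax : ℝ) →
        (Kmin : ℝ) ≤ m + b ∧ m + b ≤ (Kmax : ℝ) := by
      intro m a b ha0 ha1 hb0 hb1 hl hu
      have h₁ : (Kmin : ℝ) < ((m + 1 : ℤ) : ℝ) := by push_cast; linarith
      have h₂ : (m : ℝ) < Kmax := by linarith
      have h₁' : Kmin ≤ m := Int.lt_add_one_iff.mp (by exact_mod_cast h₁)
      have h₂' : m + 1 ≤ Kmax := Int.add_one_le_iff.mpr (by exact_mod_cast h₂)
      have h₁'' : (Kmin : ℝ) ≤ m := by exact_mod_cast h₁'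
      have h₂'' : (m : ℝ) + 1 ≤ Kmax := by exact_mod_cast h₂'
      constructor <;> linarith
    by_cases hij : r j = i
    · subst hij
      have hb := hgrp (r j)
      rw [hm] at hb ⊢
      have := key m (p j) (p j + t) hj0 hj1 (by linarith) htj hb.1 hb.2
      simpa [hne.symm, add_assoc] using this
    by_cases hik : r k = i
    · subst hik
      have hb := hgrp (r k)
      rw [hm'] at hb ⊢
      have := key m' (p k) (p k - t) hk0 hk1 htk (by linarith) hb.1 hb.2
      simpa [hne, add_sub_assoc] using this
    · simpa [hij, hik] using hgrp i
  · rw [hsum]; simpa using htot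
  · have : ∑ l, f l * q l = ∑ l, f l * p l + f j * t - f k * t := by
      simp [hq, mul_add, mul_sub, Finset.sum_add_distrib, Finset.sum_sub_distrib]
    rw [this]
    nlinarith [mul_le_mul_of_nonneg_right hf ht0]
  · have hsub : (univ.filter fun l => q l ≠ 0 ∧ q l ≠ 1) ⊆
        univ.filter fun l => p l ≠ 0 ∧ p l ≠ 1 := by
      intro l hl
      simp only [mem_filter, mem_univ, true_and] at hl ⊢
      by_cases h : l = j
      · subst h; exact hj
      by_cases h' : l = k
      · subst h'; exact hk
      rwa [hql l h h'] at hl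
    rw [Finset.ssubset_iff_of_subset hsub]
    rcases ht with h | h
    · exact ⟨j, by simp [hj], by simp [hqj, h]⟩
    · exact ⟨k, by simp [hk], by simp [hqk, h]⟩

theorem exists_zero_one_le {J : Type*} [Fintype J] {n : ℕ} {r : J → Fin n}
    {Kmin Kmax Kav : ℤ} (f : J → ℝ) {p : J → ℝ}
    (hp : p ∈ neighborhoodPolytope r Kmin Kmax Kav) :
    ∃ q ∈ neighborhoodPolytope r Kmin Kmax Kav, (∀ j, q j = 0 ∨ q j = 1) ∧
      ∑ l, f l * q l ≤ ∑ l, f l * p l := by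
  classical
  induction hs : (univ.filter fun l => p l ≠ 0 ∧ p l ≠ 1) using Finset.strongInduction
    generalizing p with
  | H s ih =>
    by_cases hint : ∀ j, p j = 0 ∨ p j = 1
    · exact ⟨p, hp, hint, le_rfl⟩
    push Not at hint
    obtain ⟨j₀, hj₀⟩ := hint
    obtain ⟨j, k, hjk, hj, hk, hex⟩ := exists_exchangeable hp hj₀
    obtain ⟨q, hqS, hqf, hqs⟩ : ∃ q ∈ neighborhoodPolytope r Kmin Kmax Kav,
        ∑ l, f l * q l ≤ ∑ l, f l * p l ∧
        (univ.filter fun l => q l ≠ 0 ∧ q l ≠ 1) ⊂ univ.filter fun l => p l ≠ 0 ∧ p l ≠ 1 := by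
      rcases le_total (f j) (f k) with h | h
      · convert exists_exchange_step hp hjk hj hk hex h
      · convert exists_exchange_step hp hjk.symm hk hj hex.symm h
    obtain ⟨q', hq'S, hq', hle⟩ := ih _ (hs ▸ hqs) hqS rfl
    exact ⟨q', hq'S, hq', hle.trans hqf⟩

/-- The LNML neighborhood-learning linear program, minimizing `pᵀf` over the
target-neighborhood polytope, always admits an integer 0-1 optimal solution. -/
theorem LNML_linear_program_has_zero_one_optimum
    {J : Type*} [Fintype J] (n : ℕ) (hn : 0 < n) (r : J → Fin n)
    (Kmin Kmax Kav : ℤ) (h₁ : Kmin ≤ Kav) (h₂ : Kav ≤ Kmax)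
    (S : Set (J → ℝ))
    (hS : S = {p : J → ℝ |
      (∀ j, 0 ≤ p j ∧ p j ≤ 1) ∧
      (∀ i : Fin n,
        (Kmin : ℝ) ≤ ∑ j ∈ univ.filter (fun j => r j = i), p j ∧
        ∑ j ∈ univ.filter (fun j => r j = i), p j ≤ (Kmax : ℝ)) ∧
      (∑ j, p j = (Kav : ℝ) * n)})
    (hne : S.Nonempty) :
    ∀ f : J → ℝ, ∃ pstar ∈ S, (∀ j, pstar j = 0 ∨ pstar j = 1) ∧
      ∀ p ∈ S, ∑ j, f j * pstar j ≤ ∑ j, f j * p j := by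
  intro f
  change S = neighborhoodPolytope r Kmin Kmax Kav at hS
  subst hS
  have hfin : {q ∈ neighborhoodPolytope r Kmin Kmax Kav | ∀ j, q j = 0 ∨ q j = 1}.Finite := by
    refine (Set.Finite.pi' fun _ : J => Set.toFinite ({0, 1} : Set ℝ)).subset ?_
    intro q hq j
    simpa using hq.2 j
  obtain ⟨p₀, hp₀⟩ := hne
  obtain ⟨q₀, hq₀S, hq₀, -⟩ := exists_zero_one_le f hp₀
  obtain ⟨q, hq, hmin⟩ := Set.exists_min_image _ (fun q => ∑ j, f j * q j) hfin ⟨q₀, hq₀S, hq₀⟩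
  refine ⟨q, hq.1, hq.2, fun p hp => ?_⟩
  obtain ⟨q', hq'S, hq', hle⟩ := exists_zero_one_le f hp
  exact (hmin q' ⟨hq'S, hq'⟩).trans hle
end
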